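/- In the community (sharing-economy) setting with N users, the infimum (in the extended reals) of the community LP cost over all community-LP-feasible tuples is less than or equal to the infimum of the community original cost over all community-original-feasible tuples. -/

import Mathlib

noncomputable section

/-- Saturation of `z` to the interval `[l, u]`. -/
def clamp (z l u : ℝ) : ℝ := max l (min z u)

/-- Feasibility for the community ORIGINAL sizing problem with `N` users. -/
def CommOrigFeas (K N : ℕ) (Y X : ℕ → ℕ → ℝ) (αbar αlow γ R amax Chat : ℝ)
    (a : ℕ → ℝ) (Cbar : ℝ) (C : ℕ → ℝ) : Prop :=
  0 ≤ Cbar ∧ (∀ i ∈ Finset.Icc 1 N, 0 ≤ a i ∧ a i ≤ amax) ∧ C 0 = Chat ∧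
  ∀ k ∈ Finset.Icc 1 K,
    C k = clamp (γ * C (k - 1) +
        ∑ i ∈ Finset.Icc 1 N, (a i * Y i (k - 1) - X i (k - 1)))
        (αlow * Cbar) (αbar * Cbar) ∧
    |C k - C (k - 1)| ≤ R * Cbar

/-- Cost of the community ORIGINAL sizing problem. -/
def CommJorig (K N : ℕ) (Y X : ℕ → ℕ → ℝ) (PiPV PiB PiR PiG αbar αlow γ : ℝ)
    (a : ℕ → ℝ) (Cbar : ℝ) (C : ℕ → ℝ) : ℝ :=
  PiB * Cbar + ∑ i ∈ Finset.Icc 1 N, PiPV * a i +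
    ∑ k ∈ Finset.Icc 1 K,
      (PiR * max ((γ * C (k - 1) +
          ∑ i ∈ Finset.Icc 1 N, (a i * Y i (k - 1) - X i (k - 1))) -
          αbar * Cbar) 0 +
       PiG * max (αlow * Cbar - (γ * C (k - 1) +
          ∑ i ∈ Finset.Icc 1 N, (a i * Y i (k - 1) - X i (k - 1)))) 0)

/-- Feasibility for the community LP problem with `N` users. -/
def CommLPFeas (K N : ℕ) (Y X : ℕ → ℕ → ℝ) (αbar αlow γ R amax Chat : ℝ)
    (a : ℕ → ℝ) (Cbar : ℝ) (C φp φm : ℕ → ℝ) : Prop :=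
  0 ≤ Cbar ∧ (∀ i ∈ Finset.Icc 1 N, 0 ≤ a i ∧ a i ≤ amax) ∧ C 0 = Chat ∧
  ∀ k ∈ Finset.Icc 1 K,
    C k + φp k - φm k = γ * C (k - 1) +
      ∑ i ∈ Finset.Icc 1 N, (a i * Y i (k - 1) - X i (k - 1)) ∧
    αlow * Cbar ≤ C k ∧ C k ≤ αbar * Cbar ∧
    0 ≤ φp k ∧ 0 ≤ φm k ∧
    |C k - C (k - 1)| ≤ R * Cbar

/-- Cost of the community LP problem. -/
def CommJLP (K N : ℕ) (PiPV PiB PiR PiG : ℝ) (a : ℕ → ℝ) (Cbar : ℝ)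
    (φp φm : ℕ → ℝ) : ℝ :=
  PiB * Cbar + ∑ i ∈ Finset.Icc 1 N, PiPV * a i +
    ∑ k ∈ Finset.Icc 1 K, (PiR * φp k + PiG * φm k)

/-- Saturating `z` to `[l, u]` leaves the excess `z - u` and the deficit `l - z`. -/
theorem clamp_add_excess_sub_deficit {z l u : ℝ} (h : l ≤ u) :
    clamp z l u + max (z - u) 0 - max (l - z) 0 = z := by
  unfold clamp
  grind

theorem le_clamp (z l u : ℝ) : l ≤ clamp z l u := le_max_left _ _

theorem clamp_le {z l u : ℝ} (h : l ≤ u) : clamp z l u ≤ u :=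
  max_le h (min_le_right _ _)

/-- In the community (sharing-economy) setting, the infimum (in the extended
reals) of the community LP cost over community-LP-feasible tuples is at most
the infimum of the community original cost over community-original-feasible
tuples. -/
theorem comm_LP_inf_le_comm_orig_inf
    (K N : ℕ) (hK : 1 ≤ K) (hN : 1 ≤ N) (Y X : ℕ → ℕ → ℝ)
    (PiPV PiB PiR PiG : ℝ) (αbar αlow γ R amax Chat : ℝ)
    (hαbar : 1 / 2 < αbar ∧ αbar ≤ 1) (hαlow : 0 ≤ αlow ∧ αlow < 1 / 2)
    (hγ : 0 < γ ∧ γ ≤ 1) (hR : 0 < R ∧ R ≤ 1) (hamax : 0 ≤ amax) :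
    sInf {c : EReal | ∃ (a : ℕ → ℝ) (Cbar : ℝ) (C φp φm : ℕ → ℝ),
        CommLPFeas K N Y X αbar αlow γ R amax Chat a Cbar C φp φm ∧
        c = ((CommJLP K N PiPV PiB PiR PiG a Cbar φp φm : ℝ) : EReal)} ≤
    sInf {c : EReal | ∃ (a : ℕ → ℝ) (Cbar : ℝ) (C : ℕ → ℝ),
        CommOrigFeas K N Y X αbar αlow γ R amax Chat a Cbar C ∧
        c = ((CommJorig K N Y X PiPV PiB PiR PiG αbar αlow γ a Cbar C : ℝ) : EReal)} := by
  apply sInf_le_sInf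
  rintro c ⟨a, Cbar, C, ⟨hCbar, ha, hC0, hC⟩, rfl⟩
  have hlu : αlow * Cbar ≤ αbar * Cbar :=
    mul_le_mul_of_nonneg_right (by linarith [hαlow.2, hαbar.1]) hCbar
  let z : ℕ → ℝ := fun k => γ * C (k - 1) +
    ∑ i ∈ Finset.Icc 1 N, (a i * Y i (k - 1) - X i (k - 1))
  refine ⟨a, Cbar, C, fun k => max (z k - αbar * Cbar) 0,
    fun k => max (αlow * Cbar - z k) 0, ⟨hCbar, ha, hC0, fun k hk => ?_⟩, rfl⟩
  obtain ⟨hCk, hramp⟩ := hC k hk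
  change C k = clamp (z k) _ _ at hCk
  refine ⟨?_, ?_, ?_, le_max_right _ _, le_max_right _ _, hramp⟩
  · rw [hCk]
    exact clamp_add_excess_sub_deficit hlu
  · rw [hCk]
    exact le_clamp _ _ _
  · rw [hCk]
    exact clamp_le hlu

end
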